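/- arXiv:2507.00725 — 2 statements merged into one kernel-verified Lean document; each statement's English description precedes it below -/
import Mathlib

section
/- Let K be an abstract simplicial complex on a vertex type V, let g : V → ℝ be obtained from f : V → ℝ by a single crossing of two vertices u and v of K, and suppose {u, v} ∈ K. Then the lower link of v before the crossing decomposes as Lk⁻_f(v) = Lk⁻_g(v) ∪ (u ⋆ I_uv), and moreover Lk⁻_g(v) ∩ (u ⋆ I_uv) = I_uv. In particular, Lk⁻_g(v) = Lk⁻_f(v) \ { σ ∈ K : u ∈ σ }. -/
open Finset

open scoped Classical

/-- An abstract simplicial complex on vertex type `V`: a finite collection of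
nonempty finite subsets, closed under passing to nonempty subsets. -/
def IsComplex {V : Type*} [DecidableEq V] (K : Finset (Finset V)) : Prop :=
  (∀ σ ∈ K, σ.Nonempty) ∧ ∀ σ ∈ K, ∀ τ ⊆ σ, τ.Nonempty → τ ∈ K

/-- `v` is a vertex of `K` if it belongs to some simplex. -/
def IsVertex {V : Type*} [DecidableEq V] (K : Finset (Finset V)) (v : V) : Prop :=
  ∃ σ ∈ K, v ∈ σ

/-- `f` is injective on the vertices of `K`. -/
def InjOnVerts {V : Type*} [DecidableEq V] (K : Finset (Finset V)) (f : V → ℝ) : Prop :=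
  ∀ a b, IsVertex K a → IsVertex K b → f a = f b → a = b

/-- The lower link of a vertex `w` with respect to `f`. -/
noncomputable def lowerLink {V : Type*} [DecidableEq V] (K : Finset (Finset V))
    (f : V → ℝ) (w : V) : Finset (Finset V) :=
  K.filter (fun τ => w ∉ τ ∧ insert w τ ∈ K ∧ ∀ x ∈ τ, f x < f w)

/-- Reduced Euler characteristic of a finite collection of nonempty finite sets. -/
noncomputable def chiTilde {V : Type*} [DecidableEq V] (L : Finset (Finset V)) : ℤ :=
  (∑ τ ∈ L, (-1 : ℤ) ^ (τ.card - 1)) - 1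

/-- The cone `v ⋆ L`. -/
noncomputable def cone {V : Type*} [DecidableEq V] (v : V) (L : Finset (Finset V)) :
    Finset (Finset V) :=
  L ∪ L.image (insert v) ∪ {{v}}

/-- `g` is obtained from `f` by a single crossing of the vertices `u` and `v` of `K`. -/
structure IsCrossing {V : Type*} [DecidableEq V] (K : Finset (Finset V))
    (f g : V → ℝ) (u v : V) : Prop where
  injf : InjOnVerts K f
  injg : InjOnVerts K g
  hu : IsVertex K u
  hv : IsVertex K v
  huv : f u < f v
  hvu : g v < g u
  others : ∀ a b, IsVertex K a → IsVertex K b → ({a, b} : Set V) ≠ ({u, v} : Set V) →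
    (f a < f b ↔ g a < g b)

/-- `I_uv`, the lower link of the edge `{u, v}` with respect to `f`. -/
noncomputable def edgeLowerLink {V : Type*} [DecidableEq V] (K : Finset (Finset V))
    (f : V → ℝ) (u v : V) : Finset (Finset V) :=
  K.filter (fun τ => u ∉ τ ∧ v ∉ τ ∧ insert u (insert v τ) ∈ K ∧
    ∀ x ∈ τ, f x < min (f u) (f v))

namespace IsCrossing

variable {V : Type*} [DecidableEq V] {K : Finset (Finset V)} {f g : V → ℝ} {u v x : V}
  {τ : Finset V}

theorem ne (h : IsCrossing K f g u v) : u ≠ v := by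
  rintro rfl
  exact lt_irrefl _ h.huv

/-- The order of a third vertex relative to the upper crossing vertex does not change. -/
theorem lt_right_iff (h : IsCrossing K f g u v) (hx : IsVertex K x) (hxu : x ≠ u) :
    f x < f v ↔ g x < g v := by
  refine h.others x v hx h.hv fun he => ?_
  have hu : u ∈ ({x, v} : Set V) := he ▸ Set.mem_insert u {v}
  rcases hu with hu | hu
  · exact hxu hu.symm
  · exact h.ne hu

/-- No third vertex lies between the two crossing vertices. -/
theorem lt_left_of_lt_right (h : IsCrossing K f g u v) (hx : IsVertex K x) (hxu : x ≠ u)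
    (hxv : x ≠ v) (hlt : f x < f v) : f x < f u := by
  refine (h.others x u hx h.hu fun he => ?_).2 (((h.lt_right_iff hx hxu).1 hlt).trans h.hvu)
  have hx' : x ∈ ({u, v} : Set V) := he ▸ Set.mem_insert x {u}
  rcases hx' with hx' | hx'
  · exact hxu hx'
  · exact hxv hx'

theorem mem_lowerLink_iff (h : IsCrossing K f g u v) :
    τ ∈ lowerLink K g v ↔ τ ∈ lowerLink K f v ∧ u ∉ τ := by
  simp only [lowerLink, mem_filter]
  constructor
  · rintro ⟨hτ, hv, hi, hlt⟩
    have hu : u ∉ τ := fun hu => lt_asymm (hlt u hu) h.hvu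
    exact ⟨⟨hτ, hv, hi, fun x hx => (h.lt_right_iff ⟨τ, hτ, hx⟩
      (ne_of_mem_of_not_mem hx hu)).2 (hlt x hx)⟩, hu⟩
  · rintro ⟨⟨hτ, hv, hi, hlt⟩, hu⟩
    exact ⟨hτ, hv, hi, fun x hx => (h.lt_right_iff ⟨τ, hτ, hx⟩
      (ne_of_mem_of_not_mem hx hu)).1 (hlt x hx)⟩

theorem edgeLowerLink_subset (hK : IsComplex K) (h : IsCrossing K f g u v) :
    edgeLowerLink K f u v ⊆ lowerLink K g v := by
  intro τ hτ
  simp only [edgeLowerLink, mem_filter] at hτ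
  obtain ⟨hτ, hu, hv, hi, hlt⟩ := hτ
  refine h.mem_lowerLink_iff.2 ⟨?_, hu⟩
  simp only [lowerLink, mem_filter]
  exact ⟨hτ, hv, hK.2 _ hi _ (subset_insert _ _) (insert_nonempty _ _),
    fun x hx => (hlt x hx).trans_le (min_le_right _ _)⟩

/-- The simplices of the cone `u ⋆ I_uv` containing `u` are those of the lower link of `v`. -/
theorem mem_cone_iff_of_mem (hK : IsComplex K) (h : IsCrossing K f g u v)
    (hedge : ({u, v} : Finset V) ∈ K) (hu : u ∈ τ) :
    τ ∈ cone u (edgeLowerLink K f u v) ↔ τ ∈ lowerLink K f v := by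
  simp only [cone, edgeLowerLink, lowerLink, mem_union, mem_image, mem_filter, mem_singleton]
  constructor
  · rintro ((⟨-, hu', -⟩ | ⟨σ, ⟨-, -, hv, hi, hlt⟩, rfl⟩) | rfl)
    · exact absurd hu hu'
    · refine ⟨hK.2 _ hi _ (insert_subset_insert _ (subset_insert _ _)) (insert_nonempty _ _),
        ?_, by rwa [insert_comm], ?_⟩
      · simp [hv, h.ne.symm]
      · intro x hx
        rcases mem_insert.1 hx with rfl | hx
        · exact h.huv
        · exact (hlt x hx).trans_le (min_le_right _ _)
    · refine ⟨hK.2 _ hedge _ (by simp) (singleton_nonempty _), ?_, ?_, ?_⟩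
      · simpa using h.ne.symm
      · rwa [pair_comm]
      · simpa using h.huv
  · rintro ⟨hτ, hv, hi, hlt⟩
    rcases (τ.erase u).eq_empty_or_nonempty with he | he
    · exact Or.inr (by rw [← insert_erase hu, he]; rfl)
    · refine Or.inl (Or.inr ⟨τ.erase u, ⟨hK.2 _ hτ _ (erase_subset _ _) he,
        notMem_erase _ _, fun hv' => hv (mem_of_mem_erase hv'), ?_, ?_⟩, insert_erase hu⟩)
      · rwa [insert_comm, insert_erase hu]
      · intro x hx
        have hx' := mem_of_mem_erase hx
        exact lt_min (h.lt_left_of_lt_right ⟨τ, hτ, hx'⟩ (ne_of_mem_erase hx)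
          (ne_of_mem_of_not_mem hx' hv) (hlt x hx')) (hlt x hx')

end IsCrossing

theorem mem_cone_iff_of_notMem {V : Type*} [DecidableEq V] {L : Finset (Finset V)} {u : V}
    {τ : Finset V} (hu : u ∉ τ) : τ ∈ cone u L ↔ τ ∈ L := by
  simp only [cone, mem_union, mem_image, mem_singleton]
  refine ⟨?_, fun h => Or.inl (Or.inl h)⟩
  rintro ((h | ⟨σ, -, rfl⟩) | rfl)
  · exact h
  · exact absurd (mem_insert_self _ _) hu
  · exact absurd (mem_singleton_self _) hu

/-- if `{u,v} ∈ K`, then before the crossing the lower link of `v`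
decomposes as `Lk⁻_f(v) = Lk⁻_g(v) ∪ (u ⋆ I_uv)`, with intersection `I_uv`; in
particular `Lk⁻_g(v) = Lk⁻_f(v) \ {σ ∈ K : u ∈ σ}`. -/
theorem crossing_lowerLink_v_decomp {V : Type*} [DecidableEq V]
    (K : Finset (Finset V)) (hK : IsComplex K) (f g : V → ℝ) (u v : V)
    (hcross : IsCrossing K f g u v) (hedge : ({u, v} : Finset V) ∈ K) :
    lowerLink K f v = lowerLink K g v ∪ cone u (edgeLowerLink K f u v) ∧
      lowerLink K g v ∩ cone u (edgeLowerLink K f u v) = edgeLowerLink K f u v ∧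
      lowerLink K g v = lowerLink K f v \ K.filter (fun σ => u ∈ σ) := by
  have hsub := hcross.edgeLowerLink_subset hK
  refine ⟨?_, ?_, ?_⟩ <;> ext τ
  · rw [mem_union, hcross.mem_lowerLink_iff]
    by_cases hu : u ∈ τ
    · simp [hu, hcross.mem_cone_iff_of_mem hK hedge hu]
    · have hle := fun hτ => (hcross.mem_lowerLink_iff.1 (@hsub τ hτ)).1
      simpa [hu, mem_cone_iff_of_notMem hu] using hle
  · rw [mem_inter]
    refine ⟨fun ⟨hg, hc⟩ => ?_, fun hτ => ?_⟩
    · exact (mem_cone_iff_of_notMem (hcross.mem_lowerLink_iff.1 hg).2).1 hc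
    · exact ⟨hsub hτ, (mem_cone_iff_of_notMem (hcross.mem_lowerLink_iff.1 (hsub hτ)).2).2 hτ⟩
  · rw [mem_sdiff, mem_filter, hcross.mem_lowerLink_iff]
    refine and_congr_right fun hτ => ?_
    have hτK : τ ∈ K := (mem_filter.1 hτ).1
    simp [hτK]
end

section
/- Let K be an abstract simplicial complex on a vertex type V, let g : V → ℝ be obtained from f : V → ℝ by a single crossing of two vertices u and v of K, and suppose {u, v} ∈ K. Then the reduced Euler characteristic of the lower link of u changes by χ̃(Lk⁻_g(u)) − χ̃(Lk⁻_f(u)) = −χ̃(I_uv). (This is the Euler-characteristic identity the paper derives for u from the Mayer–Vietoris sequence applied to the decomposition Lk⁻_g(u) = Lk⁻_f(u) ∪ (v ⋆ I_uv), using that the cone v ⋆ I_uv is contractible.) -/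
open Finset

open scoped Classical

/-- Vertices other than `v` have the same order relation to `u` before and after the crossing. -/
theorem IsCrossing.lt_iff {V : Type*} [DecidableEq V] {K : Finset (Finset V)} {f g : V → ℝ}
    {u v x : V} (h : IsCrossing K f g u v) (hx : IsVertex K x) (hxv : x ≠ v) :
    f x < f u ↔ g x < g u := by
  refine h.others x u hx h.hu fun he => ?_
  have hv : v ∈ ({x, u} : Set V) := he ▸ Set.mem_insert_of_mem u rfl
  rcases hv with hv | hv
  · exact hxv hv.symm
  · exact absurd h.huv (by rw [Set.mem_singleton_iff.mp hv]; exact lt_irrefl _)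

/-- After the crossing, the lower link of `u` gains the joins of `v` with the (possibly empty)
simplices of the lower link of the edge. -/
theorem IsCrossing.lowerLink_eq {V : Type*} [DecidableEq V] {K : Finset (Finset V)}
    (hK : IsComplex K) {f g : V → ℝ} {u v : V} (h : IsCrossing K f g u v)
    (hedge : ({u, v} : Finset V) ∈ K) :
    lowerLink K g u =
      lowerLink K f u ∪ (insert ∅ (edgeLowerLink K f u v)).image (insert v) := by
  have huv : u ≠ v := fun e => lt_irrefl (f u) (by simpa [e] using h.huv)
  have hmin : min (f u) (f v) = f u := min_eq_left h.huv.le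
  ext τ
  simp only [lowerLink, edgeLowerLink, mem_union, mem_image, mem_filter, mem_insert, hmin]
  constructor
  · rintro ⟨hτ, huτ, hins, hlt⟩
    by_cases hv : v ∈ τ
    · refine Or.inr ⟨τ.erase v, ?_, insert_erase hv⟩
      rcases (τ.erase v).eq_empty_or_nonempty with he | hne
      · exact Or.inl he
      · refine Or.inr ⟨hK.2 τ hτ _ (erase_subset v τ) hne, fun hu => huτ (mem_of_mem_erase hu),
          notMem_erase v τ, by rwa [insert_erase hv], fun x hx => ?_⟩
        exact (h.lt_iff ⟨τ, hτ, mem_of_mem_erase hx⟩ (ne_of_mem_erase hx)).2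
          (hlt x (mem_of_mem_erase hx))
    · exact Or.inl ⟨hτ, huτ, hins, fun x hx =>
        (h.lt_iff ⟨τ, hτ, hx⟩ fun e => hv (e ▸ hx)).2 (hlt x hx)⟩
  · rintro (⟨hτ, huτ, hins, hlt⟩ | ⟨σ, rfl | ⟨hσ, huσ, hvσ, hins, hlt⟩, rfl⟩)
    · exact ⟨hτ, huτ, hins, fun x hx =>
        (h.lt_iff ⟨τ, hτ, hx⟩ fun e => (h.huv.trans (e ▸ hlt x hx)).false).1 (hlt x hx)⟩
    · refine ⟨hK.2 _ hedge _ (by simp) (by simp), by simpa using huv, by simpa using hedge, ?_⟩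
      simpa using h.hvu
    · refine ⟨hK.2 _ hins _ (subset_insert _ _) (insert_nonempty _ _), by simp [huv, huσ],
        hins, fun x hx => ?_⟩
      rcases mem_insert.mp hx with rfl | hx
      · exact h.hvu
      · exact (h.lt_iff ⟨σ, hσ, hx⟩ fun e => hvσ (e ▸ hx)).1 (hlt x hx)

/-- Coning the nonempty sets of `L`, together with the empty set, shifts dimensions by one. -/
theorem sum_image_insert_eq_neg_chiTilde {V : Type*} [DecidableEq V] {L : Finset (Finset V)}
    {v : V} (hne : ∀ σ ∈ L, σ.Nonempty) (hv : ∀ σ ∈ L, v ∉ σ) :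
    ∑ τ ∈ (insert ∅ L).image (insert v), (-1 : ℤ) ^ (τ.card - 1) = -chiTilde L := by
  have hv' : ∀ σ ∈ insert ∅ L, v ∉ σ := by simpa using hv
  have hempty : ∅ ∉ L := fun h => not_nonempty_empty (hne ∅ h)
  rw [sum_image fun σ hσ τ hτ e => by
    rw [← erase_insert (hv' σ hσ), e, erase_insert (hv' τ hτ)], sum_insert hempty, chiTilde,
    neg_sub, sub_eq_add_neg, ← sum_neg_distrib]
  congr 1
  refine sum_congr rfl fun σ hσ => ?_
  obtain ⟨n, hn⟩ := Nat.exists_eq_succ_of_ne_zero (hne σ hσ).card_pos.ne'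
  simp [card_insert_of_notMem (hv σ hσ), hn, pow_succ]

/-- if `{u,v} ∈ K`, the reduced Euler characteristic of the lower link
of `u` changes by `-χ̃(I_uv)` at the crossing. -/
theorem crossing_chiTilde_u {V : Type*} [DecidableEq V]
    (K : Finset (Finset V)) (hK : IsComplex K) (f g : V → ℝ) (u v : V)
    (hcross : IsCrossing K f g u v) (hedge : ({u, v} : Finset V) ∈ K) :
    chiTilde (lowerLink K g u) - chiTilde (lowerLink K f u) =
      -chiTilde (edgeLowerLink K f u v) := by
  have hdisj : Disjoint (lowerLink K f u)
      ((insert ∅ (edgeLowerLink K f u v)).image (insert v)) := by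
    refine disjoint_left.mpr fun τ hτ hτ' => ?_
    obtain ⟨σ, -, rfl⟩ := mem_image.mp hτ'
    exact hcross.huv.not_gt ((mem_filter.mp hτ).2.2.2 v (mem_insert_self v σ))
  rw [← sum_image_insert_eq_neg_chiTilde (L := edgeLowerLink K f u v) (v := v)
      (fun σ hσ => hK.1 σ (mem_filter.mp hσ).1)
      fun σ hσ => (mem_filter.mp hσ).2.2.1,
    hcross.lowerLink_eq hK hedge, chiTilde, chiTilde, sum_union hdisj]
  ring
end
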